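/- arXiv:math/0606076 — 3 statements merged into one kernel-verified Lean document; each statement's English description precedes it below -/
import Mathlib

section
/- Let m ≥ 1 and r ≥ 1 be integers. Then the function ε ↦ ∑_{n=1}^∞ n^m e^{nrε} − m!/(−rε)^{m+1}, defined for complex ε with Re(ε) < 0, extends to a holomorphic function on the disc {|ε| < 2π/r} whose Taylor expansion at 0 is ∑_{j=0}^∞ ζ(−m − j)·(rε)^j/j!, where ζ denotes the Riemann zeta function. In other words, for Re(ε) < 0 and |ε| small, ∑_{n=1}^∞ n^m e^{nrε} = m!/(−rε)^{m+1} + ∑_{j=0}^∞ ζ(−m − j)·(rε)^j/j!. -/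
open Complex

/-- The exponential generating function `z / (exp z - 1)` of the Bernoulli numbers, with its
removable singularity at `0` filled in. -/
noncomputable def bernoulliGenFun (z : ℂ) : ℂ := (dslope Complex.exp 0 z)⁻¹

/-- The function `1 / (exp (-z) - 1) + 1 / z`, with its removable singularity at `0` filled in. -/
noncomputable def zetaGenFun (z : ℂ) : ℂ := -dslope (fun w => bernoulliGenFun (-w)) 0 z

lemma exp_ne_one_of_norm_lt {z : ℂ} (hz : ‖z‖ < 2 * Real.pi) (h0 : z ≠ 0) :
    Complex.exp z ≠ 1 := by
  intro h
  obtain ⟨n, rfl⟩ := Complex.exp_eq_one_iff.mp h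
  have hn : n ≠ 0 := by
    rintro rfl
    simp at h0
  have h1 : (1 : ℝ) ≤ |(n : ℝ)| := by exact_mod_cast Int.one_le_abs hn
  have h2 : ‖(n : ℂ) * (2 * Real.pi * I)‖ = |(n : ℝ)| * (2 * Real.pi) := by
    simp [abs_of_pos Real.pi_pos]
  rw [h2] at hz
  nlinarith [Real.pi_pos]

lemma dslope_exp_ne_zero {z : ℂ} (hz : ‖z‖ < 2 * Real.pi) : dslope Complex.exp 0 z ≠ 0 := by
  rcases eq_or_ne z 0 with rfl | h0
  · simp
  · intro h
    have := sub_smul_dslope Complex.exp 0 z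
    rw [h, smul_zero, Complex.exp_zero, eq_comm, sub_eq_zero] at this
    exact exp_ne_one_of_norm_lt hz h0 this

lemma bernoulliGenFun_mul_exp_sub_one {z : ℂ} (hz : ‖z‖ < 2 * Real.pi) :
    bernoulliGenFun z * (Complex.exp z - 1) = z := by
  have h := sub_smul_dslope Complex.exp 0 z
  rw [Complex.exp_zero, sub_zero, smul_eq_mul] at h
  rw [← h, bernoulliGenFun, mul_comm z, inv_mul_cancel_left₀ (dslope_exp_ne_zero hz)]

lemma differentiableOn_bernoulliGenFun :
    DifferentiableOn ℂ bernoulliGenFun (Metric.ball 0 (2 * Real.pi)) := by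
  refine DifferentiableOn.inv ?_ fun z hz => dslope_exp_ne_zero (mem_ball_zero_iff.mp hz)
  exact (Complex.differentiableOn_dslope (Metric.ball_mem_nhds 0 Real.two_pi_pos)).mpr
    Complex.differentiable_exp.differentiableOn

lemma differentiableOn_zetaGenFun :
    DifferentiableOn ℂ zetaGenFun (Metric.ball 0 (2 * Real.pi)) := by
  refine DifferentiableOn.neg
    ((Complex.differentiableOn_dslope (Metric.ball_mem_nhds 0 Real.two_pi_pos)).mpr ?_)
  refine differentiableOn_bernoulliGenFun.comp differentiable_neg.differentiableOn fun z hz => ?_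
  simpa using hz

lemma mul_zetaGenFun (z : ℂ) : z * zetaGenFun z = 1 - bernoulliGenFun (-z) := by
  have h := sub_smul_dslope (fun w => bernoulliGenFun (-w)) 0 z
  have h0 : bernoulliGenFun 0 = 1 := by simp [bernoulliGenFun]
  simp only [sub_zero, smul_eq_mul, neg_zero, h0] at h
  rw [zetaGenFun, mul_neg, h, neg_sub]

lemma contDiffAt_zero_of_differentiableOn {f : ℂ → ℂ}
    (hf : DifferentiableOn ℂ f (Metric.ball 0 (2 * Real.pi))) {n : WithTop ℕ∞} :
    ContDiffAt ℂ n f 0 :=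
  (hf.analyticAt (Metric.ball_mem_nhds 0 Real.two_pi_pos)).contDiffAt

lemma iteratedDeriv_bernoulliGenFun_zero (n : ℕ) :
    iteratedDeriv n bernoulliGenFun 0 = bernoulli n := by
  induction n using Nat.strong_induction_on with
  | _ n ih =>
    have hmul : (fun z => bernoulliGenFun z * (Complex.exp z - 1)) =ᶠ[nhds 0] fun z => z := by
      filter_upwards [Metric.ball_mem_nhds (0 : ℂ) Real.two_pi_pos] with z hz
      exact bernoulliGenFun_mul_exp_sub_one (mem_ball_zero_iff.mp hz)
    have hid : iteratedDeriv (n + 1) (fun z : ℂ => z) 0 = if n + 1 = 1 then 1 else 0 := by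
      rw [iteratedDeriv_succ']
      rcases n with _ | n <;> simp [iteratedDeriv_const]
    have hexp (k : ℕ) :
        iteratedDeriv k (fun z : ℂ => Complex.exp z - 1) 0 = if k = 0 then 0 else 1 := by
      rcases k with _ | k
      · simp
      · rw [iteratedDeriv_succ']
        simp [iteratedDeriv_eq_iterate]
    have h := hmul.iteratedDeriv_eq (n + 1)
    rw [iteratedDeriv_fun_mul (contDiffAt_zero_of_differentiableOn differentiableOn_bernoulliGenFun)
      (by fun_prop), hid, Finset.sum_range_succ, Nat.sub_self, hexp, if_pos rfl, mul_zero,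
      add_zero, Finset.sum_range_succ] at h
    have hB := congrArg (Rat.cast : ℚ → ℂ) (sum_bernoulli (n + 1))
    rw [Finset.sum_range_succ] at hB
    simp only [Rat.cast_add, Rat.cast_sum, Rat.cast_mul, Rat.cast_natCast,
      apply_ite (Rat.cast : ℚ → ℂ), Rat.cast_one, Rat.cast_zero] at hB
    rw [← hB] at h
    have hsum : ∑ k ∈ Finset.range n, ((n + 1).choose k : ℂ) *
        iteratedDeriv k bernoulliGenFun 0 *
          iteratedDeriv (n + 1 - k) (fun z : ℂ => Complex.exp z - 1) 0 =
        ∑ k ∈ Finset.range n, ((n + 1).choose k : ℂ) * bernoulli k := by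
      refine Finset.sum_congr rfl fun k hk => ?_
      have hk := Finset.mem_range.mp hk
      rw [ih k hk, hexp, if_neg (by omega), mul_one]
    rw [hsum, hexp, if_neg (by omega), mul_one, add_right_inj] at h
    exact mul_left_cancel₀ (Nat.cast_ne_zero.mpr (Nat.choose_pos n.le_succ).ne') h

lemma iteratedDeriv_zetaGenFun_zero (n : ℕ) :
    iteratedDeriv n zetaGenFun 0 = riemannZeta (-n) := by
  have h : iteratedDeriv (n + 1) (fun z => z * zetaGenFun z) 0 =
      iteratedDeriv (n + 1) (fun z => 1 - bernoulliGenFun (-z)) 0 := by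
    simp only [mul_zetaGenFun]
  have hid (k : ℕ) : iteratedDeriv k (fun z : ℂ => z) 0 = if k = 1 then 1 else 0 := by
    rcases k with _ | k
    · simp
    · rw [iteratedDeriv_succ']
      rcases k with _ | k <;> simp [iteratedDeriv_const]
  rw [iteratedDeriv_fun_mul contDiffAt_fun_id
    (contDiffAt_zero_of_differentiableOn differentiableOn_zetaGenFun),
    Finset.sum_eq_single 1 (fun k _ hk => by simp [hid, hk]) (by simp), hid, if_pos rfl,
    iteratedDeriv_const_sub n.succ_pos, iteratedDeriv_neg, iteratedDeriv_comp_neg, neg_zero,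
    iteratedDeriv_bernoulliGenFun_zero] at h
  simp only [Nat.choose_one_right, mul_one, Nat.add_sub_cancel, smul_eq_mul] at h
  have hn : (n : ℂ) + 1 ≠ 0 := Nat.cast_add_one_ne_zero n
  rw [riemannZeta_neg_nat_eq_bernoulli, eq_div_iff hn, mul_comm]
  push_cast at h
  rw [h, pow_succ]
  ring

lemma differentiableOn_iteratedDeriv_zetaGenFun (m : ℕ) :
    DifferentiableOn ℂ (iteratedDeriv m zetaGenFun) (Metric.ball 0 (2 * Real.pi)) := by
  induction m with
  | zero => simpa using differentiableOn_zetaGenFun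
  | succ m ih =>
    rw [iteratedDeriv_succ]
    exact ih.deriv Metric.isOpen_ball

lemma hasSum_iteratedDeriv_zetaGenFun (m : ℕ) {z : ℂ} (hz : ‖z‖ < 2 * Real.pi) :
    HasSum (fun j : ℕ => riemannZeta (-(m : ℂ) - j) * z ^ j / (j.factorial : ℂ))
      (iteratedDeriv m zetaGenFun z) := by
  refine (Complex.hasSum_taylorSeries_on_ball (differentiableOn_iteratedDeriv_zetaGenFun m)
    (mem_ball_zero_iff.mpr hz)).congr_fun fun j => ?_
  have h : iteratedDeriv j (iteratedDeriv m zetaGenFun) 0 = riemannZeta (-(m : ℂ) - j) := by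
    rw [show -(m : ℂ) - j = -((j + m : ℕ) : ℂ) by push_cast; ring,
      ← iteratedDeriv_zetaGenFun_zero, iteratedDeriv_eq_iterate, iteratedDeriv_eq_iterate,
      iteratedDeriv_eq_iterate, Function.iterate_add_apply]
  rw [h, sub_zero, smul_eq_mul, smul_eq_mul]
  ring

lemma hasSum_exp_eq_zetaGenFun {z : ℂ} (hz : ‖z‖ < 2 * Real.pi) (hre : z.re < 0) :
    HasSum (fun n : ℕ => Complex.exp (((n : ℂ) + 1) * z)) (1 / (-z) + zetaGenFun z) := by
  have hz0 : z ≠ 0 := by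
    rintro rfl
    simp at hre
  have hlt : ‖Complex.exp z‖ < 1 := by rwa [Complex.norm_exp, Real.exp_lt_one_iff]
  have h := (hasSum_geometric_of_norm_lt_one hlt).mul_left (Complex.exp z)
  have hne : 1 - Complex.exp z ≠ 0 :=
    sub_ne_zero.mpr (exp_ne_one_of_norm_lt hz hz0).symm
  have hB := bernoulliGenFun_mul_exp_sub_one (z := -z) (by rwa [norm_neg])
  have hH := mul_zetaGenFun z
  rw [Complex.exp_neg] at hB
  have he := Complex.exp_ne_zero z
  convert! h using 1
  · ext n
    rw [← Complex.exp_nat_mul, ← Complex.exp_add]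
    ring_nf
  · have hB' : bernoulliGenFun (-z) * (1 - Complex.exp z) = -z * Complex.exp z := by
      field_simp at hB
      linear_combination hB
    have hH' : bernoulliGenFun (-z) = 1 - z * zetaGenFun z := by rw [hH]; ring
    rw [hH'] at hB'
    field_simp
    linear_combination -hB'

lemma hasDerivAt_factorial_div_neg_pow (m : ℕ) {z : ℂ} (hz : z ≠ 0) :
    HasDerivAt (fun w : ℂ => (m.factorial : ℂ) / (-w) ^ (m + 1))
      (((m + 1).factorial : ℂ) / (-z) ^ (m + 1 + 1)) z := by
  have hnz : -z ≠ 0 := neg_ne_zero.mpr hz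
  have hfac : ((m + 1).factorial : ℂ) = ((m : ℂ) + 1) * m.factorial := by
    rw [Nat.factorial_succ, Nat.cast_mul, Nat.cast_add_one]
  refine ((hasDerivAt_const z (m.factorial : ℂ)).fun_div ((hasDerivAt_neg z).fun_pow (m + 1))
    (pow_ne_zero (m + 1) hnz)).congr_deriv ?_
  rw [hfac, Nat.add_sub_cancel, Nat.cast_add_one,
    div_eq_div_iff (pow_ne_zero _ (pow_ne_zero _ hnz)) (pow_ne_zero _ hnz)]
  ring

lemma hasSum_pow_mul_exp (m : ℕ) {z : ℂ} (hz : ‖z‖ < 2 * Real.pi) (hre : z.re < 0) :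
    HasSum (fun n : ℕ => ((n : ℂ) + 1) ^ m * Complex.exp (((n : ℂ) + 1) * z))
      ((m.factorial : ℂ) / (-z) ^ (m + 1) + iteratedDeriv m zetaGenFun z) := by
  induction m generalizing z with
  | zero => simpa using hasSum_exp_eq_zetaGenFun hz hre
  | succ m ih =>
    have hz0 : z ≠ 0 := by
      rintro rfl
      simp at hre
    have hderiv (n : ℕ) (w : ℂ) :
        HasDerivAt (fun w => ((n : ℂ) + 1) ^ m * Complex.exp (((n : ℂ) + 1) * w))
          (((n : ℂ) + 1) ^ (m + 1) * Complex.exp (((n : ℂ) + 1) * w)) w := by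
      refine ((((hasDerivAt_id' w).const_mul ((n : ℂ) + 1)).cexp).const_mul
        (((n : ℂ) + 1) ^ m)).congr_deriv ?_
      ring
    have hu : Summable fun n : ℕ => ((n : ℝ) + 1) ^ m * Real.exp (z.re / 2) ^ (n + 1) := by
      have h := summable_pow_mul_geometric_of_norm_lt_one m (r := Real.exp (z.re / 2))
        (by rw [Real.norm_eq_abs, Real.abs_exp, Real.exp_lt_one_iff]; linarith)
      simpa using (summable_nat_add_iff 1).mpr h
    have hopen : IsOpen {w : ℂ | w.re < z.re / 2} :=
      isOpen_lt Complex.continuous_re continuous_const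
    have hsum := Complex.hasSum_deriv_of_summable_norm hu
      (fun n w _ => (hderiv n w).differentiableAt.differentiableWithinAt) hopen
      (fun n w hw => by
        rw [norm_mul, norm_pow, Complex.norm_exp, ← Real.exp_nat_mul]
        have h1 : ‖(n : ℂ) + 1‖ = (n : ℝ) + 1 := by
          exact_mod_cast Complex.norm_natCast (n + 1)
        have h2 : (((n : ℂ) + 1) * w).re = ((n : ℝ) + 1) * w.re := by simp
        rw [h1, h2]
        push_cast
        have := le_of_lt (Set.mem_ofPred.mp hw)
        gcongr)
      (show z.re < z.re / 2 by linarith)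
    simp only [fun n => (hderiv n z).deriv] at hsum
    have heq : (fun w => ∑' n : ℕ, ((n : ℂ) + 1) ^ m * Complex.exp (((n : ℂ) + 1) * w)) =ᶠ[nhds z]
        fun w => (m.factorial : ℂ) / (-w) ^ (m + 1) + iteratedDeriv m zetaGenFun w := by
      filter_upwards [Metric.isOpen_ball.mem_nhds (mem_ball_zero_iff.mpr hz),
        (isOpen_lt Complex.continuous_re continuous_const).mem_nhds hre] with w hw hw'
      exact (ih (mem_ball_zero_iff.mp hw) hw').tsum_eq
    have hG := ((differentiableOn_iteratedDeriv_zetaGenFun m).differentiableAt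
      (Metric.isOpen_ball.mem_nhds (mem_ball_zero_iff.mpr hz))).hasDerivAt
    have hP := hasDerivAt_factorial_div_neg_pow m hz0
    rw [heq.deriv_eq, (hP.fun_add hG).deriv, ← iteratedDeriv_succ] at hsum
    exact hsum

/-- For integers `m, r ≥ 1`, the function `ε ↦ ∑_{n≥1} n^m e^{nrε} - m!/(-rε)^{m+1}`
(defined for `Re ε < 0`) extends holomorphically to the disc `|ε| < 2π/r`, with Taylor
expansion `∑_{j≥0} ζ(-m-j)·(rε)^j/j!` at `0`. -/
theorem sum_pow_exp_expansion (m r : ℕ) (hm : 1 ≤ m) (hr : 1 ≤ r) :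
    ∃ G : ℂ → ℂ,
      DifferentiableOn ℂ G (Metric.ball (0 : ℂ) (2 * Real.pi / r)) ∧
      (∀ ε : ℂ, ε ∈ Metric.ball (0 : ℂ) (2 * Real.pi / r) → ε.re < 0 →
        HasSum (fun n : ℕ => ((n : ℂ) + 1) ^ m * Complex.exp (((n : ℂ) + 1) * r * ε))
          ((Nat.factorial m : ℂ) / (-(r * ε)) ^ (m + 1) + G ε)) ∧
      (∀ ε : ℂ, ε ∈ Metric.ball (0 : ℂ) (2 * Real.pi / r) →
        HasSum (fun j : ℕ => riemannZeta (-(m : ℂ) - (j : ℂ)) * (r * ε) ^ j /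
          (Nat.factorial j : ℂ)) (G ε)) := by
  have hr0 : (0 : ℝ) < r := by exact_mod_cast hr
  have hball {ε : ℂ} (hε : ε ∈ Metric.ball (0 : ℂ) (2 * Real.pi / r)) :
      ‖(r : ℂ) * ε‖ < 2 * Real.pi := by
    rw [mem_ball_zero_iff, lt_div_iff₀ hr0] at hε
    rwa [norm_mul, Complex.norm_natCast, mul_comm]
  refine ⟨fun ε => iteratedDeriv m zetaGenFun (r * ε), ?_, fun ε hε hre => ?_, fun ε hε =>
    hasSum_iteratedDeriv_zetaGenFun m (hball hε)⟩
  · exact (differentiableOn_iteratedDeriv_zetaGenFun m).comp (by fun_prop)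
      fun ε hε => mem_ball_zero_iff.mpr (hball hε)
  · simpa only [mul_assoc] using hasSum_pow_mul_exp m (hball hε) (by
      simpa using mul_neg_of_pos_of_neg hr0 hre)
end

section
/- Let k ≥ 2 and 1 ≤ ℓ < k, let s = (s_1, …, s_k) ∈ ℤ^k with s_1 = s_2 = ⋯ = s_ℓ = 0 and s_i ≤ 0 for all i, let r = (r_1, …, r_k) with each r_i > 0, and let ε ∈ ℂ with Re(ε) < 0. Then Z(s, r; ε) = Z((0, …, 0), (r_1, …, r_ℓ); ε) · Z((s_{ℓ+1}, s_{ℓ+2}, …, s_k), (r_1 + ⋯ + r_ℓ + r_{ℓ+1}, r_{ℓ+2}, …, r_k); ε). -/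
/-- Strictly decreasing `k`-tuples of positive integers `n₁ > n₂ > ⋯ > n_k > 0`. -/
def DecSeq (k : ℕ) : Type := {n : Fin k → ℕ // StrictAnti n ∧ ∀ i, 0 < n i}

/-- The directional regularized multiple zeta value
`Z(s, r; ε) = ∑_{n₁ > ⋯ > n_k > 0} ∏ᵢ e^{nᵢ rᵢ ε} / nᵢ^{sᵢ}`. -/
noncomputable def Zreg (k : ℕ) (s : Fin k → ℤ) (r : Fin k → ℝ) (ε : ℂ) : ℂ :=
  ∑' n : DecSeq k, ∏ i, Complex.exp ((n.1 i : ℂ) * (r i : ℂ) * ε) / ((n.1 i : ℂ) ^ (s i))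

/-- A product of summable nonnegative sequences in independent variables is summable. -/
theorem summable_prod_pi_nat {k : ℕ} (f : Fin k → ℕ → ℝ) (hf0 : ∀ i n, 0 ≤ f i n)
    (hf : ∀ i, Summable (f i)) : Summable fun n : Fin k → ℕ => ∏ i, f i (n i) := by
  induction k with
  | zero => exact Summable.of_finite
  | succ k ih =>
    rw [← (Fin.consEquiv fun _ : Fin (k + 1) => ℕ).summable_iff]
    have h := (hf 0).mul_of_nonneg (ih (fun i => f i.succ) (fun i => hf0 i.succ)
      fun i => hf i.succ) (hf0 0) fun n => Finset.prod_nonneg fun i _ => hf0 i.succ (n i)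
    refine h.congr fun p => ?_
    simp [Fin.prod_univ_succ, Fin.consEquiv]

/-- Absolute convergence of the series defining `Zreg` for nonpositive exponents. -/
theorem summable_norm_Zreg {k : ℕ} {s : Fin k → ℤ} {r : Fin k → ℝ} {ε : ℂ}
    (hs : ∀ i, s i ≤ 0) (hr : ∀ i, 0 < r i) (hε : ε.re < 0) :
    Summable fun n : DecSeq k =>
      ‖∏ i, Complex.exp ((n.1 i : ℂ) * (r i : ℂ) * ε) / ((n.1 i : ℂ) ^ (s i))‖ := by
  have h := summable_prod_pi_nat
    (fun (i : Fin k) (n : ℕ) => ‖Complex.exp ((n : ℂ) * (r i : ℂ) * ε) / ((n : ℂ) ^ (s i))‖)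
    (fun _ _ => norm_nonneg _) fun i => by
      obtain ⟨d, hd⟩ := Int.eq_ofNat_of_zero_le (neg_nonneg.2 (hs i))
      refine (Real.summable_pow_mul_exp_neg_nat_mul d
        (mul_pos (hr i) (neg_pos.2 hε))).congr fun n => ?_
      rw [show s i = -(d : ℤ) by omega, zpow_neg, zpow_natCast, div_inv_eq_mul, norm_mul,
        norm_pow, Complex.norm_natCast, Complex.norm_exp, mul_comm]
      congr 2
      simp [Complex.mul_re]
      ring
  refine (h.comp_injective Subtype.val_injective).congr fun n => ?_
  simp [norm_prod]

/-- Splitting a decreasing tuple after its first `ℓ` entries, and subtracting the next entry from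
each of these, is a bijection. -/
def DecSeq.appendEquiv (ℓ m : ℕ) : DecSeq ℓ × DecSeq (m + 1) ≃ DecSeq (ℓ + (m + 1)) where
  toFun p := ⟨Fin.append (fun i => p.1.1 i + p.2.1 0) p.2.1, by
    obtain ⟨⟨a, ha, ha0⟩, ⟨b, hb, hb0⟩⟩ := p
    refine ⟨fun i j => ?_, fun i => ?_⟩
    · induction i using Fin.addCases with
      | left i =>
        induction j using Fin.addCases with
        | left j =>
          intro h
          simpa using ha (show i < j from h)
        | right j =>
          intro _
          have h1 := hb.antitone (Fin.zero_le j)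
          have h2 := ha0 i
          simp only [Fin.append_left, Fin.append_right]
          omega
      | right i =>
        induction j using Fin.addCases with
        | left j =>
          intro h
          have h : ℓ + (i : ℕ) < j := h
          omega
        | right j =>
          intro h
          have h : ℓ + (i : ℕ) < ℓ + j := h
          simpa using hb (show i < j from Fin.lt_def.2 (by omega))
    · induction i using Fin.addCases with
      | left i => simp [ha0]
      | right i => simp [hb0]⟩
  invFun n := ⟨⟨fun i => n.1 (Fin.castAdd _ i) - n.1 (Fin.natAdd ℓ 0), by
      obtain ⟨n, hn, hn0⟩ := n
      have h (i : Fin ℓ) : n (Fin.natAdd ℓ 0) < n (Fin.castAdd (m + 1) i) :=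
        hn (Fin.lt_def.2 (by simp))
      refine ⟨fun i j hij => ?_, fun i => Nat.sub_pos_of_lt (h i)⟩
      have h1 := hn (show Fin.castAdd (m + 1) i < Fin.castAdd (m + 1) j from hij)
      have h2 := h j
      dsimp only
      omega⟩,
    ⟨fun i => n.1 (Fin.natAdd ℓ i), fun i j hij =>
      n.2.1 (Fin.lt_def.2 (by simpa using hij)), fun i => n.2.2 _⟩⟩
  left_inv p := by
    refine Prod.ext (Subtype.ext ?_) (Subtype.ext ?_) <;> ext i <;> simp
  right_inv n := by
    refine Subtype.ext (funext fun i => ?_)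
    induction i using Fin.addCases with
    | left i =>
      have h := n.2.1.antitone (show Fin.castAdd (m + 1) i ≤ Fin.natAdd ℓ 0 from
        Fin.le_def.2 (by simp))
      simpa using Nat.sub_add_cancel h
    | right i => simp

/-- The factorization of `Zreg` for tuples indexed by `Fin (ℓ + (m + 1))`. -/
theorem Zreg_add_eq_mul (ℓ m : ℕ) (s : Fin (ℓ + (m + 1)) → ℤ)
    (hs0 : ∀ i : Fin ℓ, s (Fin.castAdd _ i) = 0) (hs : ∀ i, s i ≤ 0)
    (r : Fin (ℓ + (m + 1)) → ℝ) (hr : ∀ i, 0 < r i) (r' : Fin (m + 1) → ℝ)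
    (hr0 : r' 0 = ∑ i : Fin ℓ, r (Fin.castAdd _ i) + r (Fin.natAdd ℓ 0))
    (hr' : ∀ i : Fin m, r' i.succ = r (Fin.natAdd ℓ i.succ)) (ε : ℂ) (hε : ε.re < 0) :
    Zreg (ℓ + (m + 1)) s r ε =
      Zreg ℓ (fun _ => 0) (fun i => r (Fin.castAdd _ i)) ε *
        Zreg (m + 1) (fun i => s (Fin.natAdd ℓ i)) r' ε := by
  have hr'_pos : ∀ i, 0 < r' i := by
    refine Fin.cases ?_ fun i => ?_
    · rw [hr0]
      exact add_pos_of_nonneg_of_pos (Finset.sum_nonneg fun i _ => (hr _).le) (hr _)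
    · rw [hr']
      exact hr _
  unfold Zreg
  rw [tsum_mul_tsum_of_summable_norm (summable_norm_Zreg (fun _ => le_rfl) (fun i => hr _) hε)
    (summable_norm_Zreg (fun i => hs _) hr'_pos hε), ← (DecSeq.appendEquiv ℓ m).tsum_eq]
  refine tsum_congr fun ⟨⟨a, _⟩, ⟨b, _⟩⟩ => ?_
  have hexp : Complex.exp ((b 0 : ℂ) * (r' 0 : ℂ) * ε) =
      (∏ i : Fin ℓ, Complex.exp ((b 0 : ℂ) * (r (Fin.castAdd _ i) : ℂ) * ε)) *
        Complex.exp ((b 0 : ℂ) * (r (Fin.natAdd ℓ 0) : ℂ) * ε) := by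
    rw [← Complex.exp_sum, ← Complex.exp_add, hr0]
    push_cast
    rw [← Finset.sum_mul, ← Finset.mul_sum]
    ring_nf
  change ∏ i, Complex.exp (((Fin.append (fun i => a i + b 0) b i : ℕ) : ℂ) * (r i : ℂ) * ε) /
      (((Fin.append (fun i => a i + b 0) b i : ℕ) : ℂ) ^ (s i)) =
    (∏ i : Fin ℓ, Complex.exp ((a i : ℂ) * (r (Fin.castAdd _ i) : ℂ) * ε) / (a i : ℂ) ^ (0 : ℤ)) *
      ∏ i : Fin (m + 1), Complex.exp ((b i : ℂ) * (r' i : ℂ) * ε) /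
        (b i : ℂ) ^ s (Fin.natAdd ℓ i)
  rw [Fin.prod_univ_add]
  simp only [Fin.append_left,
    Fin.append_right, hs0, zpow_zero, div_one, Nat.cast_add, add_mul, Complex.exp_add,
    Finset.prod_mul_distrib]
  simp only [Fin.prod_univ_succ (n := m), hr', hexp]
  ring

/-- If `s₁ = ⋯ = s_ℓ = 0` (with `ℓ < k`) and all `sᵢ ≤ 0`, then
`Z(s, r; ε) = Z((0,…,0),(r₁,…,r_ℓ); ε) ·
Z((s_{ℓ+1},…,s_k), (r₁+⋯+r_ℓ+r_{ℓ+1}, r_{ℓ+2}, …, r_k); ε)`. -/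
theorem Zreg_zero_cluster_factorization (k ℓ : ℕ) (hk : 2 ≤ k) (hℓ : 1 ≤ ℓ) (hℓk : ℓ < k)
    (s : Fin k → ℤ) (hs0 : ∀ i : Fin k, (i : ℕ) < ℓ → s i = 0) (hs : ∀ i, s i ≤ 0)
    (r : Fin k → ℝ) (hr : ∀ i, 0 < r i) (ε : ℂ) (hε : ε.re < 0) :
    Zreg k s r ε =
      Zreg ℓ (fun _ => 0) (fun i => r ⟨i.val, by have := i.isLt; omega⟩) ε *
        Zreg (k - ℓ)
          (fun i => s ⟨ℓ + i.val, by have := i.isLt; omega⟩)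
          (fun i =>
            if (i : ℕ) = 0 then ∑ t : Fin (ℓ + 1), r ⟨t.val, by have := t.isLt; omega⟩
            else r ⟨ℓ + i.val, by have := i.isLt; omega⟩) ε := by
  obtain ⟨m, rfl⟩ : ∃ m, k = ℓ + (m + 1) := ⟨k - ℓ - 1, by omega⟩
  have key (q : ℕ) (hq : q = m + 1) : Zreg (ℓ + (m + 1)) s r ε =
      Zreg ℓ (fun _ => 0) (fun i => r ⟨i.val, by have := i.isLt; omega⟩) ε *
        Zreg q (fun i => s ⟨ℓ + i.val, by have := i.isLt; omega⟩)
          (fun i =>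
            if (i : ℕ) = 0 then ∑ t : Fin (ℓ + 1), r ⟨t.val, by have := t.isLt; omega⟩
            else r ⟨ℓ + i.val, by have := i.isLt; omega⟩) ε := by
    subst hq
    refine Zreg_add_eq_mul ℓ m s (fun i => hs0 _ i.isLt) hs r hr _ ?_ (fun i => ?_) ε hε
    · simp only [Fin.val_zero, if_true, Fin.sum_univ_castSucc]
      rfl
    · simp only [Fin.val_succ, Nat.succ_ne_zero, if_false]
      rfl
  exact key _ (by omega)
end

section
/- Let m ≥ 1 and ℓ ≥ 0 be integers, let s′ = (s′_1, …, s′_ℓ) ∈ ℤ^ℓ with s′_i ≥ 1 for all i and s′_1 ≥ 2 when ℓ ≥ 1, let r′ = (r′_1, …, r′_ℓ) ∈ ℤ_{>0}^ℓ, and let c > 0 be real. Then there exists a polynomial P ∈ ℂ[X] of degree exactly m, whose leading coefficient equals ζ(s′_1, …, s′_ℓ)/m! if ℓ ≥ 1 and equals 1/m! if ℓ = 0, such that Z((1, …, 1, s′_1, …, s′_ℓ), (c, …, c, r′_1, …, r′_ℓ); ε) − P(−log c − log(−ε)) → 0 as real ε → 0⁻, where the argument vector begins with m entries equal to 1 paired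 with m entries equal to c. -/
open Filter

section

open Finset Topology

/-- The finite nested sum `∑_{M > n₁ > ⋯ > n_k ≥ 0} f₁(n₁) ⋯ f_k(n_k)`. -/
def nestedSum : List (ℕ → ℝ) → ℕ → ℝ
  | [], _ => 1
  | f :: fs, M => ∑ n ∈ range M, f n * nestedSum fs n

/-- Strictly decreasing `k`-tuples with entries in `{1, …, M}`. -/
def boundedDecTuples (k M : ℕ) : Finset (Fin k → ℕ) :=
  (Fintype.piFinset fun _ => Icc 1 M).filter fun n => StrictAnti n

lemma mem_boundedDecTuples {k M : ℕ} {n : Fin k → ℕ} :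
    n ∈ boundedDecTuples k M ↔ (∀ i, 0 < n i ∧ n i ≤ M) ∧ StrictAnti n := by
  simp [boundedDecTuples, Nat.succ_le_iff]

lemma strictAnti_cons_iff {k : ℕ} {a : ℕ} {n : Fin k → ℕ} :
    StrictAnti (Fin.cons a n : Fin (k + 1) → ℕ) ↔ (∀ i, n i < a) ∧ StrictAnti n := by
  constructor
  · intro h
    refine ⟨fun i => ?_, fun i j hij => ?_⟩
    · simpa using h (Fin.succ_pos i)
    · simpa using h (Fin.succ_lt_succ_iff.mpr hij)
  · rintro ⟨ha, h⟩ i j hij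
    induction i using Fin.cases with
    | zero =>
      induction j using Fin.cases with
      | zero => exact absurd hij (lt_irrefl _)
      | succ j => simpa using ha j
    | succ i =>
      induction j using Fin.cases with
      | zero => exact absurd hij (Fin.not_lt_zero _)
      | succ j => simpa using h (Fin.succ_lt_succ_iff.mp hij)

lemma sum_boundedDecTuples (k : ℕ) (F : Fin k → ℕ → ℝ) (M : ℕ) :
    ∑ n ∈ boundedDecTuples k M, ∏ i, F i (n i - 1) = nestedSum (List.ofFn F) M := by
  induction k generalizing M with
  | zero =>
    have : boundedDecTuples 0 M = {Fin.elim0} := by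
      ext n
      simp [mem_boundedDecTuples, Subsingleton.elim n Fin.elim0, StrictAnti]
    simp [this, nestedSum]
  | succ k ih =>
    simp only [List.ofFn_succ, nestedSum, ← ih, mul_sum]
    rw [sum_sigma']
    symm
    refine sum_bij' (fun x _ => (Fin.cons (x.1 + 1) x.2 : Fin (k + 1) → ℕ))
      (fun n _ => (⟨n 0 - 1, Fin.tail n⟩ : (_ : ℕ) × (Fin k → ℕ))) ?_ ?_ ?_ ?_ ?_
    · rintro ⟨j, n⟩ h
      simp only [mem_sigma, mem_range, mem_boundedDecTuples] at h
      obtain ⟨hj, hn, ha⟩ := h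
      dsimp only at hn ha ⊢
      rw [mem_boundedDecTuples, strictAnti_cons_iff]
      refine ⟨fun i => ?_, fun i => by have := hn i; omega, ha⟩
      induction i using Fin.cases with
      | zero => simp only [Fin.cons_zero]; omega
      | succ i => have := hn i; simp only [Fin.cons_succ]; omega
    · intro n h
      rw [mem_boundedDecTuples] at h
      obtain ⟨hn, ha⟩ := h
      simp only [mem_sigma, mem_range, mem_boundedDecTuples, Fin.tail]
      refine ⟨by have := hn 0; omega, fun i => ?_, fun i j hij => ha (by simpa using hij)⟩
      have h1 := hn i.succ
      have h2 := ha (Fin.succ_pos i)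
      omega
    · rintro ⟨j, n⟩ h
      simp
    · intro n h
      rw [mem_boundedDecTuples] at h
      have : n 0 - 1 + 1 = n 0 := by have := h.1 0; omega
      simp [this]
    · rintro ⟨j, n⟩ h
      simp [Fin.prod_univ_succ]

/-- A nested series with nonnegative terms converges as soon as its partial sums do. -/
lemma hasSum_decSeq {k : ℕ} {F : Fin k → ℕ → ℝ} (hF : ∀ i n, 0 ≤ F i n) {L : ℝ}
    (h : Tendsto (nestedSum (List.ofFn F)) atTop (𝓝 L)) :
    HasSum (fun n : DecSeq k => ∏ i, F i (n.1 i - 1)) L := by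
  classical
  let D : ℕ → Finset (DecSeq k) := fun M =>
    (boundedDecTuples k M).subtype fun n => StrictAnti n ∧ ∀ i, 0 < n i
  have hD : ∀ M, ∑ n ∈ D M, ∏ i, F i (n.1 i - 1) = nestedSum (List.ofFn F) M := by
    intro M
    rw [← sum_boundedDecTuples]
    refine Finset.sum_subtype_of_mem (fun n : Fin k → ℕ => ∏ i, F i (n i - 1)) fun n hn => ?_
    rw [mem_boundedDecTuples] at hn
    exact ⟨hn.2, fun i => (hn.1 i).1⟩
  have hmem : ∀ M (n : DecSeq k), n ∈ D M ↔ ∀ i, n.1 i ≤ M := by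
    intro M n
    refine Finset.mem_subtype.trans (mem_boundedDecTuples.trans ?_)
    exact ⟨fun h i => (h.1 i).2, fun h => ⟨fun i => ⟨n.2.2 i, h i⟩, n.2.1⟩⟩
  have hmono : Monotone D := fun a b hab n hn =>
    (hmem b n).2 fun i => ((hmem a n).1 hn i).trans hab
  have hDtop : Tendsto D atTop atTop := by
    refine tendsto_atTop_finset_of_monotone hmono fun n => ⟨∑ i, n.1 i, (hmem _ n).2 fun i => ?_⟩
    exact single_le_sum (f := n.1) (fun _ _ => Nat.zero_le _) (mem_univ i)
  have hnn : 0 ≤ fun n : DecSeq k => ∏ i, F i (n.1 i - 1) :=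
    fun n => prod_nonneg fun i _ => hF i _
  have hmonoS : Monotone (nestedSum (List.ofFn F)) := by
    intro a b hab
    rw [← hD, ← hD]
    exact sum_le_sum_of_subset_of_nonneg (hmono hab) fun n _ _ => hnn n
  have hsum : Summable fun n : DecSeq k => ∏ i, F i (n.1 i - 1) := by
    refine summable_of_sum_le (c := L) hnn fun u => ?_
    obtain ⟨M, hM⟩ := (hDtop.eventually_ge_atTop u).exists
    refine (sum_le_sum_of_subset_of_nonneg hM fun n _ _ => hnn n).trans ?_
    rw [hD]
    exact hmonoS.ge_of_tendsto h M
  have := hsum.hasSum.comp hDtop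
  simp only [Function.comp_def] at this
  rw [← tendsto_nhds_unique (this.congr hD) h]
  exact hsum.hasSum

open PowerSeries in
/-- Recursion, in the outer bound, for the generating series over the number of leading copies
of `a` in a nested sum. -/
lemma mk_nestedSum_succ (a : ℕ → ℝ) (fs : List (ℕ → ℝ)) (M : ℕ) :
    PowerSeries.mk (fun m => nestedSum (List.replicate m a ++ fs) (M + 1)) =
      (1 + X * C (a M) : ℝ⟦X⟧) * PowerSeries.mk (fun m => nestedSum (List.replicate m a ++ fs) M)
        + C (nestedSum fs (M + 1) - nestedSum fs M) := by
  ext m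
  rw [add_mul, one_mul, mul_assoc]
  cases m with
  | zero => simp
  | succ m =>
    simp [coeff_succ_X_mul, List.replicate_succ, nestedSum, sum_range_succ]

/-- The coefficients of the inverse of `∏_{j ≤ n} (1 + a_j x)`. -/
def invCoeff (a : ℕ → ℝ) : ℕ → ℕ → ℝ
  | 0, _ => 1
  | i + 1, n => -∑ j ∈ range (n + 1), a j * invCoeff a i j

open PowerSeries in
lemma mk_nestedSum_replicate_succ (a : ℕ → ℝ) (M : ℕ) :
    PowerSeries.mk (fun m => nestedSum (List.replicate m a) (M + 1)) =
      (1 + X * C (a M) : ℝ⟦X⟧) * PowerSeries.mk (fun m => nestedSum (List.replicate m a) M) := by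
  simpa [nestedSum] using mk_nestedSum_succ a [] M

open PowerSeries in
lemma mk_nestedSum_replicate_zero (a : ℕ → ℝ) :
    PowerSeries.mk (fun m => nestedSum (List.replicate m a) 0) = 1 := by
  ext m
  cases m <;> simp [List.replicate_succ, nestedSum, coeff_one]

open PowerSeries in
lemma mk_nestedSum_mul_invCoeff (a : ℕ → ℝ) (n : ℕ) :
    PowerSeries.mk (fun m => nestedSum (List.replicate m a) (n + 1)) *
      PowerSeries.mk (fun i => invCoeff a i n) = 1 := by
  induction n with
  | zero =>
    rw [mk_nestedSum_replicate_succ, mk_nestedSum_replicate_zero, mul_one, add_mul, one_mul,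
      mul_assoc]
    ext i
    cases i <;> simp [coeff_succ_X_mul, invCoeff, coeff_one]
  | succ n ih =>
    rw [mk_nestedSum_replicate_succ, mul_comm (1 + _), mul_assoc]
    have : (1 + X * C (a (n + 1)) : ℝ⟦X⟧) * PowerSeries.mk (fun i => invCoeff a i (n + 1)) =
        PowerSeries.mk (fun i => invCoeff a i n) := by
      rw [add_mul, one_mul, mul_assoc]
      ext i
      cases i with
      | zero => simp [invCoeff]
      | succ i =>
        simp [coeff_succ_X_mul, invCoeff, sum_range_succ _ (n + 1)]
    rw [this, ih]

open PowerSeries in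
/-- The leading copies of `a` are split off from a nested sum. -/
lemma nestedSum_replicate_append_cons (a f : ℕ → ℝ) (fs : List (ℕ → ℝ)) (m M : ℕ) :
    nestedSum (List.replicate m a ++ f :: fs) M =
      ∑ p ∈ antidiagonal m, nestedSum (List.replicate p.1 a) M *
        ∑ n ∈ range M, f n * nestedSum fs n * invCoeff a p.2 n := by
  suffices h : PowerSeries.mk (fun m => nestedSum (List.replicate m a ++ f :: fs) M) =
      PowerSeries.mk (fun m => nestedSum (List.replicate m a) M) *
        PowerSeries.mk (fun i => ∑ n ∈ range M, f n * nestedSum fs n * invCoeff a i n) by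
    simpa [coeff_mul] using congrArg (coeff m) h
  induction M with
  | zero =>
    rw [mk_nestedSum_replicate_zero, one_mul]
    ext m
    cases m <;> simp [List.replicate_succ, nestedSum]
  | succ M ih =>
    have hU : PowerSeries.mk (fun i => ∑ n ∈ range (M + 1), f n * nestedSum fs n * invCoeff a i n) =
        PowerSeries.mk (fun i => ∑ n ∈ range M, f n * nestedSum fs n * invCoeff a i n) +
          C (f M * nestedSum fs M) * PowerSeries.mk (fun i => invCoeff a i M) := by
      ext i
      simp [-map_mul, coeff_C_mul, sum_range_succ]
    rw [mk_nestedSum_succ, ih, hU, mul_add, mul_left_comm _ (C _), mk_nestedSum_mul_invCoeff,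
      mk_nestedSum_replicate_succ, mul_assoc]
    simp [nestedSum, sum_range_succ]

open PowerSeries in
/-- Newton's identities for the nested sums with all entries equal to `a`. -/
lemma nestedSum_replicate_newton (a : ℕ → ℝ) (m M : ℕ) :
    nestedSum (List.replicate (m + 1) a) M * (m + 1) =
      ∑ p ∈ antidiagonal m, nestedSum (List.replicate p.1 a) M *
        ((-1) ^ p.2 * ∑ n ∈ range M, a n ^ (p.2 + 1)) := by
  suffices h : derivative ℝ (PowerSeries.mk fun m => nestedSum (List.replicate m a) M) =
      PowerSeries.mk (fun m => nestedSum (List.replicate m a) M) *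
        PowerSeries.mk (fun j => (-1) ^ j * ∑ n ∈ range M, a n ^ (j + 1)) by
    simpa [coeff_mul, coeff_derivative] using congrArg (coeff m) h
  induction M with
  | zero =>
    rw [mk_nestedSum_replicate_zero]
    ext j
    simp
  | succ M ih =>
    have hp : PowerSeries.mk (fun j => (-1) ^ j * ∑ n ∈ range (M + 1), a n ^ (j + 1)) =
        PowerSeries.mk (fun j => (-1) ^ j * ∑ n ∈ range M, a n ^ (j + 1)) +
          PowerSeries.mk (fun j => (-1) ^ j * a M ^ (j + 1)) := by
      ext j
      simp [sum_range_succ, mul_add]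
    have hg : (1 + X * C (a M) : ℝ⟦X⟧) * PowerSeries.mk (fun j => (-1) ^ j * a M ^ (j + 1)) =
        C (a M) := by
      rw [add_mul, one_mul, mul_assoc]
      ext j
      cases j with
      | zero => simp
      | succ j => simp [coeff_succ_X_mul]; ring
    have hd : derivative ℝ (1 + X * C (a M) : ℝ⟦X⟧) = C (a M) := by
      ext j
      rw [coeff_derivative]
      cases j <;> simp [coeff_one, coeff_C, coeff_X]
    rw [mk_nestedSum_replicate_succ, Derivation.leibniz, ih, hp, hd, mul_add, mul_right_comm _ _
      (PowerSeries.mk fun j => (-1) ^ j * a M ^ (j + 1)), hg]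
    simp only [smul_eq_mul]
    ring

/-- Families `u t n` that are, uniformly in `t ∈ [0, 1]`, of size `O((n + 1) ^ α)` and differ from
their value at `t = 0` by `O(t ^ δ (n + 1) ^ α)` for some `δ > 0`. -/
def HolderGrowth (α : ℝ) (u : ℝ → ℕ → ℝ) : Prop :=
  ∃ C δ : ℝ, 0 ≤ C ∧ 0 < δ ∧ ∀ t ∈ Set.Icc (0 : ℝ) 1, ∀ n : ℕ,
    |u t n| ≤ C * ((n : ℝ) + 1) ^ α ∧ |u t n - u 0 n| ≤ C * t ^ δ * ((n : ℝ) + 1) ^ α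

lemma HolderGrowth.mono {α β : ℝ} (h : α ≤ β) {u : ℝ → ℕ → ℝ} (hu : HolderGrowth α u) :
    HolderGrowth β u := by
  obtain ⟨C, δ, hC, hδ, H⟩ := hu
  refine ⟨C, δ, hC, hδ, fun t ht n => ?_⟩
  have hn : ((n : ℝ) + 1) ^ α ≤ ((n : ℝ) + 1) ^ β :=
    Real.rpow_le_rpow_of_exponent_le (by linarith [n.cast_nonneg (α := ℝ)]) h
  have ht0 : 0 ≤ t ^ δ := Real.rpow_nonneg ht.1 _
  exact ⟨(H t ht n).1.trans (by gcongr), (H t ht n).2.trans (by gcongr)⟩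

lemma HolderGrowth.neg {α : ℝ} {u : ℝ → ℕ → ℝ} (hu : HolderGrowth α u) :
    HolderGrowth α fun t n => -u t n := by
  obtain ⟨C, δ, hC, hδ, H⟩ := hu
  refine ⟨C, δ, hC, hδ, fun t ht n => ⟨by simpa using (H t ht n).1, ?_⟩⟩
  rw [← neg_sub', abs_neg]
  exact (H t ht n).2

lemma HolderGrowth.one {α : ℝ} (h : 0 ≤ α) : HolderGrowth α fun _ _ => 1 := by
  refine ⟨1, 1, zero_le_one, one_pos, fun t ht n => ⟨?_, ?_⟩⟩
  · simpa using Real.one_le_rpow (by linarith [n.cast_nonneg (α := ℝ)] : (1 : ℝ) ≤ n + 1) h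
  · have := ht.1
    simp only [sub_self, abs_zero]
    positivity

lemma HolderGrowth.mul {α β : ℝ} {u v : ℝ → ℕ → ℝ} (hu : HolderGrowth α u)
    (hv : HolderGrowth β v) : HolderGrowth (α + β) fun t n => u t n * v t n := by
  obtain ⟨C, δ, hC, hδ, H⟩ := hu
  obtain ⟨D, η, hD, hη, K⟩ := hv
  refine ⟨2 * (C * D), min δ η, by positivity, lt_min hδ hη, fun t ht n => ?_⟩
  have hn : (0 : ℝ) < n + 1 := by positivity
  have h0 : (0 : ℝ) ∈ Set.Icc (0 : ℝ) 1 := by simp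
  rw [Real.rpow_add hn]
  set A := ((n : ℝ) + 1) ^ α
  set B := ((n : ℝ) + 1) ^ β
  have hA : 0 < A := Real.rpow_pos_of_pos hn _
  have hB : 0 < B := Real.rpow_pos_of_pos hn _
  have hmin : ∀ x, 0 < x → min δ η ≤ x → t ^ x ≤ t ^ min δ η := by
    intro x hx hxm
    rcases ht.1.eq_or_lt with h | h
    · rw [← h, Real.zero_rpow hx.ne', Real.zero_rpow (lt_min hδ hη).ne']
    · exact Real.rpow_le_rpow_of_exponent_ge h ht.2 hxm
  have hT : 0 ≤ t ^ min δ η := Real.rpow_nonneg ht.1 _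
  have h1 := hmin δ hδ (min_le_left _ _)
  have h2 := hmin η hη (min_le_right _ _)
  set T := t ^ min δ η
  have e1 : |u t n - u 0 n| ≤ C * T * A := (H t ht n).2.trans (by gcongr)
  have e2 : |v t n - v 0 n| ≤ D * T * B := (K t ht n).2.trans (by gcongr)
  constructor
  · rw [abs_mul]
    calc |u t n| * |v t n| ≤ (C * A) * (D * B) := by
          gcongr
          exacts [(H t ht n).1, (K t ht n).1]
      _ ≤ 2 * ((C * A) * (D * B)) := by
          have : 0 ≤ (C * A) * (D * B) := by positivity
          linarith
      _ = _ := by ring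
  · calc |u t n * v t n - u 0 n * v 0 n|
        = |(u t n - u 0 n) * v t n + u 0 n * (v t n - v 0 n)| := by ring_nf
      _ ≤ |u t n - u 0 n| * |v t n| + |u 0 n| * |v t n - v 0 n| := by
          rw [← abs_mul, ← abs_mul]
          exact abs_add_le _ _
      _ ≤ (C * T * A) * (D * B) + (C * A) * (D * T * B) := by
          gcongr
          exacts [(K t ht n).1, (H 0 h0 n).1]
      _ = _ := by ring

lemma summable_succ_rpow {α : ℝ} (h : α < -1) : Summable fun n : ℕ => ((n : ℝ) + 1) ^ α := by
  simpa using (summable_nat_add_iff 1).2 (Real.summable_nat_rpow.2 h)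

lemma HolderGrowth.sum {α : ℝ} (hα : 0 < α) {u : ℝ → ℕ → ℝ} (hu : HolderGrowth (-1 + α) u)
    {A : ℕ → Finset ℕ} (hA : ∀ n, ∀ j ∈ A n, j ≤ n) :
    HolderGrowth (2 * α) fun t n => ∑ j ∈ A n, u t j := by
  obtain ⟨C, δ, hC, hδ, H⟩ := hu
  have hs := summable_succ_rpow (α := -1 - α) (by linarith)
  set K := ∑' n : ℕ, ((n : ℝ) + 1) ^ (-1 - α)
  have hK : 0 ≤ K := tsum_nonneg fun n => by positivity
  have key : ∀ n, ∑ j ∈ A n, ((j : ℝ) + 1) ^ (-1 + α) ≤ K * ((n : ℝ) + 1) ^ (2 * α) := by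
    intro n
    calc ∑ j ∈ A n, ((j : ℝ) + 1) ^ (-1 + α)
        ≤ ∑ j ∈ A n, ((j : ℝ) + 1) ^ (-1 - α) * ((n : ℝ) + 1) ^ (2 * α) := by
          refine sum_le_sum fun j hj => ?_
          rw [show -1 + α = (-1 - α) + 2 * α by ring, Real.rpow_add (by positivity)]
          gcongr
          exact hA n j hj
      _ = (∑ j ∈ A n, ((j : ℝ) + 1) ^ (-1 - α)) * ((n : ℝ) + 1) ^ (2 * α) := by rw [sum_mul]
      _ ≤ _ := by
          gcongr
          exact hs.sum_le_tsum _ fun j _ => by positivity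
  refine ⟨C * K, δ, by positivity, hδ, fun t ht n => ⟨?_, ?_⟩⟩
  · calc |∑ j ∈ A n, u t j| ≤ ∑ j ∈ A n, C * ((j : ℝ) + 1) ^ (-1 + α) :=
          (abs_sum_le_sum_abs _ _).trans (sum_le_sum fun j _ => (H t ht j).1)
      _ ≤ C * (K * ((n : ℝ) + 1) ^ (2 * α)) := by
          rw [← mul_sum]
          gcongr
          exact key n
      _ = _ := by ring
  · have hT : 0 ≤ t ^ δ := Real.rpow_nonneg ht.1 _
    rw [← sum_sub_distrib]
    calc |∑ j ∈ A n, (u t j - u 0 j)| ≤ ∑ j ∈ A n, C * t ^ δ * ((j : ℝ) + 1) ^ (-1 + α) :=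
          (abs_sum_le_sum_abs _ _).trans (sum_le_sum fun j _ => (H t ht j).2)
      _ ≤ C * t ^ δ * (K * ((n : ℝ) + 1) ^ (2 * α)) := by
          rw [← mul_sum]
          gcongr
          exact key n
      _ = _ := by ring

/-- The factor `e^{-(n+1) r t} / (n + 1)^s` of a regularized multiple zeta value. -/
noncomputable def expWeight (r : ℝ) (s : ℤ) (t : ℝ) (n : ℕ) : ℝ :=
  Real.exp (-(r * (n + 1) * t)) / ((n : ℝ) + 1) ^ s

lemma expWeight_pos (r : ℝ) (s : ℤ) (t : ℝ) (n : ℕ) : 0 < expWeight r s t n := by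
  unfold expWeight
  positivity

lemma one_sub_exp_neg_le_rpow {y δ : ℝ} (hy : 0 ≤ y) (hδ : 0 < δ) (hδ1 : δ ≤ 1) :
    1 - Real.exp (-y) ≤ y ^ δ := by
  rcases le_total y 1 with h | h
  · rcases hy.eq_or_lt with h0 | h0
    · simp [← h0, Real.zero_rpow hδ.ne']
    · have h1 := Real.rpow_le_rpow_of_exponent_ge h0 h hδ1
      rw [Real.rpow_one] at h1
      linarith [Real.one_sub_le_exp_neg y]
  · linarith [Real.one_le_rpow h hδ.le, Real.exp_pos (-y)]

lemma holderGrowth_expWeight {r : ℝ} (hr : 0 < r) (s : ℤ) {η : ℝ} (hη : 0 < η) :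
    HolderGrowth (-s + η) (expWeight r s) := by
  have hδ : 0 < min η 1 := lt_min hη one_pos
  set δ := min η 1
  refine ⟨1 + r ^ δ, δ, by positivity, hδ, fun t ht n => ?_⟩
  have hn : (1 : ℝ) ≤ (n : ℝ) + 1 := by linarith [n.cast_nonneg (α := ℝ)]
  have hn0 : (0 : ℝ) < (n : ℝ) + 1 := by positivity
  have ht0 := ht.1
  have hy : 0 ≤ r * ((n : ℝ) + 1) * t := by positivity
  have hs : ∀ x, expWeight r s x n =
      ((n : ℝ) + 1) ^ (-(s : ℝ)) * Real.exp (-(r * (n + 1) * x)) := by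
    intro x
    rw [Real.rpow_neg hn0.le, Real.rpow_intCast, expWeight, div_eq_inv_mul]
  have hle : ((n : ℝ) + 1) ^ (-(s : ℝ)) ≤ ((n : ℝ) + 1) ^ (-s + η) :=
    Real.rpow_le_rpow_of_exponent_le hn (by linarith)
  have hrd : 0 < r ^ δ := Real.rpow_pos_of_pos hr _
  have hp : 0 < ((n : ℝ) + 1) ^ (-s + η) := Real.rpow_pos_of_pos hn0 _
  constructor
  · rw [abs_of_pos (expWeight_pos _ _ _ _), hs]
    have h1 : Real.exp (-(r * (n + 1) * t)) ≤ 1 := Real.exp_le_one_iff.2 (by linarith)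
    calc _ ≤ ((n : ℝ) + 1) ^ (-s + η) * 1 := by gcongr
      _ ≤ _ := by nlinarith
  · rw [hs, hs, ← mul_sub, abs_mul, abs_of_pos (Real.rpow_pos_of_pos hn0 _), abs_sub_comm]
    have h1 : |Real.exp (-(r * (n + 1) * 0)) - Real.exp (-(r * (n + 1) * t))| ≤
        r ^ δ * ((n : ℝ) + 1) ^ δ * t ^ δ := by
      rw [mul_zero, neg_zero, Real.exp_zero, abs_of_nonneg
        (by linarith [Real.exp_le_one_iff.2 (neg_nonpos.2 hy)]),
        ← Real.mul_rpow hr.le hn0.le, ← Real.mul_rpow (by positivity) ht0]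
      exact one_sub_exp_neg_le_rpow hy hδ (min_le_right _ _)
    have h2 : ((n : ℝ) + 1) ^ (-(s : ℝ)) * ((n : ℝ) + 1) ^ δ ≤ ((n : ℝ) + 1) ^ (-s + η) := by
      rw [← Real.rpow_add hn0]
      exact Real.rpow_le_rpow_of_exponent_le hn (by linarith [min_le_left η 1])
    have hT : 0 ≤ t ^ δ := Real.rpow_nonneg ht0 _
    calc _ ≤ ((n : ℝ) + 1) ^ (-(s : ℝ)) * (r ^ δ * ((n : ℝ) + 1) ^ δ * t ^ δ) := by gcongr
      _ = r ^ δ * t ^ δ * (((n : ℝ) + 1) ^ (-(s : ℝ)) * ((n : ℝ) + 1) ^ δ) := by ring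
      _ ≤ (1 + r ^ δ) * t ^ δ * ((n : ℝ) + 1) ^ (-s + η) := by
          gcongr
          linarith

/-- The weights attached to a list of pairs `(r, s)`. -/
noncomputable def expWeights (l : List (ℝ × ℤ)) (t : ℝ) : List (ℕ → ℝ) :=
  l.map fun q => expWeight q.1 q.2 t

lemma holderGrowth_nestedSum {l : List (ℝ × ℤ)} (hl : ∀ q ∈ l, 0 < q.1 ∧ 1 ≤ q.2) {β : ℝ}
    (hβ : 0 < β) : HolderGrowth β fun t n => nestedSum (expWeights l t) n := by
  induction l generalizing β with
  | nil => exact HolderGrowth.one hβ.le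
  | cons q l ih =>
    have hq := hl q (by simp)
    have hq2 : (1 : ℝ) ≤ q.2 := by exact_mod_cast hq.2
    have h := (holderGrowth_expWeight hq.1 q.2 (by linarith : 0 < β / 4)).mul
      (ih (fun p hp => hl p (by simp [hp])) (by linarith : 0 < β / 4))
    have h' := (h.mono (by linarith : _ ≤ -1 + β / 2)).sum (by linarith)
      (A := range) fun n j hj => (mem_range.1 hj).le
    exact h'.mono (by linarith)

lemma holderGrowth_invCoeff {c : ℝ} (hc : 0 < c) (i : ℕ) {β : ℝ} (hβ : 0 < β) :
    HolderGrowth β fun t n => invCoeff (expWeight c 1 t) i n := by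
  induction i generalizing β with
  | zero => exact HolderGrowth.one hβ.le
  | succ i ih =>
    have h := (holderGrowth_expWeight hc 1 (by linarith : 0 < β / 4)).mul
      (ih (by linarith : 0 < β / 4))
    have h' := (h.mono (by push_cast; linarith : _ ≤ -1 + β / 2)).sum (by linarith)
      (A := fun n => range (n + 1)) fun n j hj => Nat.lt_succ_iff.1 (mem_range.1 hj)
    exact (h'.mono (by linarith)).neg

/-- Functions that tend to zero as `t → 0⁺` even after multiplication by any power of
`-log c - log t`. -/
def LogNegligible (c : ℝ) (f : ℝ → ℝ) : Prop :=
  ∀ k : ℕ, Tendsto (fun t => f t * (-Real.log c - Real.log t) ^ k) (𝓝[>] 0) (𝓝 0)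

lemma LogNegligible.add {c : ℝ} {f g : ℝ → ℝ} (hf : LogNegligible c f) (hg : LogNegligible c g) :
    LogNegligible c fun t => f t + g t := by
  intro k
  simpa [add_mul] using (hf k).add (hg k)

lemma LogNegligible.mul {c : ℝ} {f g : ℝ → ℝ} (hf : LogNegligible c f) (hg : LogNegligible c g) :
    LogNegligible c fun t => f t * g t := by
  intro k
  have h := (hf k).mul (hg 0)
  rw [mul_zero] at h
  exact h.congr fun t => by ring

lemma LogNegligible.mul_eval {c : ℝ} {f : ℝ → ℝ} (hf : LogNegligible c f) (Q : Polynomial ℝ) :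
    LogNegligible c fun t => f t * Q.eval (-Real.log c - Real.log t) := by
  induction Q using Polynomial.induction_on' with
  | add p q hp hq => simpa [mul_add] using hp.add hq
  | monomial n a =>
    intro k
    have h := (hf (n + k)).const_mul a
    rw [mul_zero] at h
    refine h.congr fun t => ?_
    simp only [Polynomial.eval_monomial]
    ring

lemma LogNegligible.of_le_rpow {c K δ : ℝ} (hδ : 0 < δ) {f : ℝ → ℝ}
    (hf : ∀ t ∈ Set.Ioc (0 : ℝ) 1, |f t| ≤ K * t ^ δ) : LogNegligible c f := by
  intro k
  set η := δ / (k + 1) with hη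
  have hη0 : 0 < η := by positivity
  have h0 : Tendsto (fun t : ℝ => t ^ η) (𝓝[>] 0) (𝓝 0) := by
    have := (Real.continuousAt_rpow_const 0 η (Or.inr hη0.le)).tendsto
    rw [Real.zero_rpow hη0.ne'] at this
    exact this.mono_left nhdsWithin_le_nhds
  have h1 : Tendsto (fun t : ℝ => t ^ η * (-Real.log c - Real.log t)) (𝓝[>] 0) (𝓝 0) := by
    have := (h0.const_mul (-Real.log c)).sub (tendsto_log_mul_rpow_nhdsGT_zero hη0)
    rw [mul_zero, sub_zero] at this
    exact this.congr fun t => by ring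
  have h2 : Tendsto (fun t : ℝ => K * (t ^ η * |t ^ η * (-Real.log c - Real.log t)| ^ k))
      (𝓝[>] 0) (𝓝 0) := by
    simpa using (h0.mul (h1.abs.pow k)).const_mul K
  refine squeeze_zero_norm' ?_ h2
  filter_upwards [Ioc_mem_nhdsGT (one_pos : (0 : ℝ) < 1)] with t ht
  have ht0 : 0 ≤ t ^ η := Real.rpow_nonneg ht.1.le _
  have hpow : t ^ δ = t ^ η * (t ^ η) ^ k := by
    rw [← pow_succ', ← Real.rpow_mul_natCast ht.1.le, hη]
    congr 1
    push_cast
    field_simp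
  rw [norm_mul, norm_pow, Real.norm_eq_abs, Real.norm_eq_abs, abs_mul, abs_of_nonneg ht0, mul_pow]
  calc |f t| * |-Real.log c - Real.log t| ^ k
      ≤ K * t ^ δ * |-Real.log c - Real.log t| ^ k := by
        gcongr
        exact hf t ht
    _ = _ := by rw [hpow]; ring

/-- The sequences `e t` converge for `t ∈ (0, 1]`, and their limit is, up to a negligible error,
a polynomial in `-log c - log t` of degree at most `d` whose coefficient of degree `d` is `κ`. -/
def LogPolyLimit (c : ℝ) (d : ℕ) (κ : ℝ) (e : ℝ → ℕ → ℝ) : Prop :=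
  ∃ (V : ℝ → ℝ) (Q : Polynomial ℝ),
    (∀ t ∈ Set.Ioc (0 : ℝ) 1, Tendsto (e t) atTop (𝓝 (V t))) ∧
    LogNegligible c (fun t => V t - Q.eval (-Real.log c - Real.log t)) ∧
    Q.natDegree ≤ d ∧ Q.coeff d = κ

lemma logPolyLimit_const (c a : ℝ) : LogPolyLimit c 0 a fun _ _ => a :=
  ⟨fun _ => a, Polynomial.C a, fun _ _ => tendsto_const_nhds, fun k => by simp, by simp, by simp⟩

lemma LogPolyLimit.add {c : ℝ} {d : ℕ} {κ μ : ℝ} {e f : ℝ → ℕ → ℝ} (he : LogPolyLimit c d κ e)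
    (hf : LogPolyLimit c d μ f) : LogPolyLimit c d (κ + μ) fun t M => e t M + f t M := by
  obtain ⟨V, Q, h1, h2, h3, h4⟩ := he
  obtain ⟨W, R, k1, k2, k3, k4⟩ := hf
  refine ⟨fun t => V t + W t, Q + R, fun t ht => (h1 t ht).add (k1 t ht), ?_,
    Polynomial.natDegree_add_le_of_degree_le h3 k3, by rw [Polynomial.coeff_add, h4, k4]⟩
  intro k
  refine (h2.add k2 k).congr fun t => ?_
  simp only [Polynomial.eval_add]
  ring

lemma LogPolyLimit.mul {c : ℝ} {d d' : ℕ} {κ μ : ℝ} {e f : ℝ → ℕ → ℝ}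
    (he : LogPolyLimit c d κ e) (hf : LogPolyLimit c d' μ f) :
    LogPolyLimit c (d + d') (κ * μ) fun t M => e t M * f t M := by
  obtain ⟨V, Q, h1, h2, h3, h4⟩ := he
  obtain ⟨W, R, k1, k2, k3, k4⟩ := hf
  refine ⟨fun t => V t * W t, Q * R, fun t ht => (h1 t ht).mul (k1 t ht), ?_,
    Polynomial.natDegree_mul_le_of_le h3 k3,
    by rw [Polynomial.coeff_mul_add_eq_of_natDegree_le h3 k3, h4, k4]⟩
  intro k
  refine (((h2.mul k2).add (h2.mul_eval R)).add (k2.mul_eval Q) k).congr fun t => ?_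
  simp only [Polynomial.eval_mul]
  ring

lemma LogPolyLimit.of_lt {c : ℝ} {d d' : ℕ} (h : d < d') {κ : ℝ} {e : ℝ → ℕ → ℝ}
    (he : LogPolyLimit c d κ e) : LogPolyLimit c d' 0 e := by
  obtain ⟨V, Q, h1, h2, h3, h4⟩ := he
  exact ⟨V, Q, h1, h2, h3.trans h.le, Polynomial.coeff_eq_zero_of_natDegree_lt (h3.trans_lt h)⟩

lemma LogPolyLimit.sum {ι : Type*} {c : ℝ} {d : ℕ} (s : Finset ι) {κ : ι → ℝ}
    {e : ι → ℝ → ℕ → ℝ} (he : ∀ i ∈ s, LogPolyLimit c d (κ i) (e i)) :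
    LogPolyLimit c d (∑ i ∈ s, κ i) fun t M => ∑ i ∈ s, e i t M := by
  classical
  induction s using Finset.induction_on with
  | empty =>
    exact ⟨fun _ => 0, 0, fun _ _ => by simp, fun k => by simp, by simp, by simp⟩
  | insert a s ha ih =>
    simp only [sum_insert ha]
    exact (he a (mem_insert_self a s)).add (ih fun i hi => he i (mem_insert_of_mem hi))

/-- A convolution of families whose degrees drop off the first index is governed by its
`(m, 0)` term. -/
lemma LogPolyLimit.sum_antidiagonal {c : ℝ} {m b : ℕ} {κ μ : ℕ → ℝ} {e f : ℕ → ℝ → ℕ → ℝ}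
    (he : ∀ i ≤ m, LogPolyLimit c i (κ i) (e i)) (hf : ∀ j, LogPolyLimit c b (μ j) (f j)) :
    LogPolyLimit c (m + b) (κ m * μ 0)
      fun t M => ∑ p ∈ antidiagonal m, e p.1 t M * f p.2 t M := by
  have h := LogPolyLimit.sum (c := c) (d := m + b) (antidiagonal m)
    (κ := fun p => if p = (m, 0) then κ m * μ 0 else 0)
    (e := fun p t M => e p.1 t M * f p.2 t M) ?_
  · simpa using h
  · rintro ⟨i, j⟩ hp
    rw [HasAntidiagonal.mem_antidiagonal] at hp
    dsimp only at hp
    have hmul := (he i (by omega)).mul (hf j)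
    by_cases hj : j = 0
    · obtain rfl : i = m := by omega
      simpa [hj] using hmul
    · have : (i, j) ≠ (m, 0) := by simp [hj]
      rw [if_neg this]
      exact hmul.of_lt (by omega)

lemma HolderGrowth.summable_and_logPolyLimit {α : ℝ} (hα : α < -1) {w : ℝ → ℕ → ℝ}
    (hw : HolderGrowth α w) (c : ℝ) :
    Summable (w 0) ∧
      LogPolyLimit c 0 (∑' n, w 0 n) fun t M => ∑ n ∈ range M, w t n := by
  obtain ⟨C, δ, hC, hδ, H⟩ := hw
  have hs := summable_succ_rpow hα
  have hsum : ∀ t ∈ Set.Icc (0 : ℝ) 1, Summable (w t) := fun t ht =>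
    Summable.of_norm_bounded (hs.mul_left C) fun n => (H t ht n).1
  have h0 : (0 : ℝ) ∈ Set.Icc (0 : ℝ) 1 := by simp
  refine ⟨hsum 0 h0, fun t => ∑' n, w t n, Polynomial.C (∑' n, w 0 n),
    fun t ht => (hsum t ⟨ht.1.le, ht.2⟩).hasSum.tendsto_sum_nat, ?_, by simp, by simp⟩
  refine LogNegligible.of_le_rpow (K := C * ∑' n : ℕ, ((n : ℝ) + 1) ^ α) hδ fun t ht => ?_
  have ht' : t ∈ Set.Icc (0 : ℝ) 1 := ⟨ht.1.le, ht.2⟩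
  rw [Polynomial.eval_C, ← (hsum t ht').tsum_sub (hsum 0 h0)]
  have := tsum_of_norm_bounded (f := fun n => w t n - w 0 n) (hs.mul_left (C * t ^ δ)).hasSum
    fun n => (H t ht' n).2
  rw [tsum_mul_left, Real.norm_eq_abs] at this
  linarith [mul_right_comm C (t ^ δ) (∑' n : ℕ, ((n : ℝ) + 1) ^ α)]

lemma expWeight_pow (c t : ℝ) (k n : ℕ) :
    expWeight c 1 t n ^ k = expWeight (k * c) k t n := by
  rw [expWeight, expWeight, div_pow, ← Real.exp_nat_mul, zpow_one, zpow_natCast]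
  congr 2
  ring

lemma logPolyLimit_sum_expWeight {c : ℝ} (hc : 0 < c) :
    LogPolyLimit c 1 1 fun t M => ∑ n ∈ range M, expWeight c 1 t n := by
  refine ⟨fun t => -Real.log (1 - Real.exp (-(c * t))), Polynomial.X, fun t ht => ?_, ?_,
    by simp, by simp⟩
  · have h1 : Real.exp (-(c * t)) < 1 := Real.exp_lt_one_iff.2 (by have := mul_pos hc ht.1; linarith)
    have h := (Real.hasSum_pow_div_log_of_abs_lt_one
      (x := Real.exp (-(c * t))) (by rwa [abs_of_pos (Real.exp_pos _)])).tendsto_sum_nat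
    refine h.congr fun M => sum_congr rfl fun n _ => ?_
    rw [expWeight, ← Real.exp_nat_mul, zpow_one]
    congr 2
    push_cast
    ring
  · refine LogNegligible.of_le_rpow (K := c) one_pos fun t ht => ?_
    have ht0 := ht.1
    have hy : 0 < c * t := mul_pos hc ht0
    have h1 : 1 - Real.exp (-(c * t)) ≤ c * t := by linarith [Real.one_sub_le_exp_neg (c * t)]
    have h2 : c * t * Real.exp (-(c * t)) ≤ 1 - Real.exp (-(c * t)) := by
      have h := Real.add_one_le_exp (c * t)
      have h' := mul_le_mul_of_nonneg_right h (Real.exp_pos (-(c * t))).le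
      rw [← Real.exp_add, add_neg_cancel, Real.exp_zero] at h'
      linarith
    have h3 : 0 < c * t * Real.exp (-(c * t)) := by positivity
    have l1 := Real.log_le_log (h3.trans_le h2) h1
    have l2 := Real.log_le_log h3 h2
    rw [Real.log_mul hy.ne' (Real.exp_pos _).ne', Real.log_exp] at l2
    rw [Real.log_mul hc.ne' ht0.ne'] at l1 l2
    rw [Polynomial.eval_X, Real.rpow_one, abs_le]
    constructor <;> linarith

lemma logPolyLimit_powerSum {c : ℝ} (hc : 0 < c) (j : ℕ) :
    ∃ κ, (j = 0 → κ = 1) ∧ LogPolyLimit c 1 κ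
      fun t M => (-1) ^ j * ∑ n ∈ range M, expWeight c 1 t n ^ (j + 1) := by
  rcases Nat.eq_zero_or_pos j with rfl | hj
  · exact ⟨1, fun _ => rfl, by simpa using logPolyLimit_sum_expWeight hc⟩
  · refine ⟨0, fun h => absurd h hj.ne', ?_⟩
    have hj' : (1 : ℝ) ≤ j := by exact_mod_cast hj
    have h := (holderGrowth_expWeight (r := (j + 1 : ℕ) * c) (by positivity) (j + 1 : ℕ)
      (one_half_pos (α := ℝ))).summable_and_logPolyLimit (by push_cast; linarith) c
    have h' := (logPolyLimit_const c ((-1) ^ j)).mul h.2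
    simp only [expWeight_pow]
    exact h'.of_lt one_pos

lemma logPolyLimit_nestedSum_replicate {c : ℝ} (hc : 0 < c) (m : ℕ) :
    LogPolyLimit c m (m.factorial : ℝ)⁻¹
      fun t M => nestedSum (List.replicate m (expWeight c 1 t)) M := by
  induction m using Nat.strong_induction_on with
  | _ m ih =>
    cases m with
    | zero => simpa [nestedSum] using logPolyLimit_const c 1
    | succ m =>
      choose μ hμ hp using logPolyLimit_powerSum hc
      have h := LogPolyLimit.sum_antidiagonal (m := m) (κ := fun i => (i.factorial : ℝ)⁻¹)
        (e := fun i t M => nestedSum (List.replicate i (expWeight c 1 t)) M)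
        (fun i hi => ih i (by omega)) hp
      have h' := (logPolyLimit_const c ((m : ℝ) + 1)⁻¹).mul h
      rw [hμ 0 rfl, zero_add] at h'
      have hm : (m : ℝ) + 1 ≠ 0 := by positivity
      convert h' using 1
      · rw [Nat.factorial_succ]
        push_cast
        rw [mul_inv, mul_one]
      · ext t M
        rw [← nestedSum_replicate_newton]
        field_simp

/-- The value at `t = 0` of a convergent tail, together with the asymptotics of the nested sums
with `m` leading entries `expWeight c 1`. -/
lemma logPolyLimit_nestedSum {c : ℝ} (hc : 0 < c) (m : ℕ) {l : List (ℝ × ℤ)}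
    (hl : ∀ q ∈ l, 0 < q.1 ∧ 1 ≤ q.2) (hl1 : ∀ q ∈ l.head?, 2 ≤ q.2) :
    ∃ ζ, Tendsto (nestedSum (expWeights l 0)) atTop (𝓝 ζ) ∧
      LogPolyLimit c m ((m.factorial : ℝ)⁻¹ * ζ) fun t M =>
        nestedSum (List.replicate m (expWeight c 1 t) ++ expWeights l t) M := by
  cases l with
  | nil =>
    refine ⟨1, tendsto_const_nhds.congr fun M => by simp [expWeights, nestedSum], ?_⟩
    simpa [expWeights] using logPolyLimit_nestedSum_replicate hc m
  | cons q l =>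
    have hq := hl q (by simp)
    have hq2 : (2 : ℝ) ≤ q.2 := by exact_mod_cast hl1 q (by simp)
    have hw : ∀ j, HolderGrowth (-3 / 2) fun t n =>
        expWeight q.1 q.2 t n * nestedSum (expWeights l t) n *
          invCoeff (expWeight c 1 t) j n := fun j =>
      (((holderGrowth_expWeight hq.1 q.2 (by norm_num : (0 : ℝ) < 1 / 6)).mul
        (holderGrowth_nestedSum (fun p hp => hl p (by simp [hp]))
          (by norm_num : (0 : ℝ) < 1 / 6))).mul
        (holderGrowth_invCoeff hc j (by norm_num : (0 : ℝ) < 1 / 6))).mono (by linarith)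
    have hU := fun j => (hw j).summable_and_logPolyLimit (by norm_num) c
    refine ⟨∑' n, expWeight q.1 q.2 0 n * nestedSum (expWeights l 0) n *
      invCoeff (expWeight c 1 0) 0 n, ?_, ?_⟩
    · refine (hU 0).1.hasSum.tendsto_sum_nat.congr fun M => ?_
      simp [expWeights, nestedSum, invCoeff]
    · have h := LogPolyLimit.sum_antidiagonal (m := m)
        (fun i _ => logPolyLimit_nestedSum_replicate hc i) fun j => (hU j).2
      simp only [expWeights, List.map_cons, nestedSum_replicate_append_cons]
      exact h

lemma prod_expWeight_eq {k : ℕ} (s : Fin k → ℤ) (r : Fin k → ℝ) (t : ℝ) (n : DecSeq k) :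
    ((∏ i, expWeight (r i) (s i) t (n.1 i - 1) : ℝ) : ℂ) =
      ∏ i, Complex.exp ((n.1 i : ℂ) * (r i : ℂ) * ((-t : ℝ) : ℂ)) / ((n.1 i : ℂ) ^ (s i)) := by
  rw [Complex.ofReal_prod]
  refine prod_congr rfl fun i _ => ?_
  have : ((n.1 i - 1 : ℕ) : ℝ) + 1 = n.1 i := by
    exact_mod_cast Nat.sub_add_cancel (n.2.2 i)
  rw [expWeight, this]
  push_cast
  congr 2
  ring

lemma hasSum_prod_expWeight {k : ℕ} (s : Fin k → ℤ) (r : Fin k → ℝ) {t L : ℝ}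
    (h : Tendsto (nestedSum (List.ofFn fun i => expWeight (r i) (s i) t)) atTop (𝓝 L)) :
    HasSum (fun n : DecSeq k => ∏ i, expWeight (r i) (s i) t (n.1 i - 1)) L :=
  hasSum_decSeq (F := fun i => expWeight (r i) (s i) t) (fun _ _ => (expWeight_pos _ _ _ _).le) h

lemma Zreg_neg_eq {k : ℕ} (s : Fin k → ℤ) (r : Fin k → ℝ) {t L : ℝ}
    (h : Tendsto (nestedSum (List.ofFn fun i => expWeight (r i) (s i) t)) atTop (𝓝 L)) :
    Zreg k s r ((-t : ℝ) : ℂ) = L := by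
  rw [Zreg, ← (Complex.hasSum_ofReal.2 (hasSum_prod_expWeight s r h)).tsum_eq]
  exact tsum_congr fun n => (prod_expWeight_eq s r t n).symm

end

/-- For `s = (1,…,1,s')` (with `m` leading ones paired with direction `c`) and convergent
tail `s'`, `Z(s, (c·1_m, r'); ε)` equals `P(-log c - log(-ε)) + o(1)` as `ε → 0⁻`, where
`P` is a polynomial of degree exactly `m` with leading coefficient `ζ(s')/m!` (or `1/m!`
when the tail is empty). -/
theorem Zreg_leading_ones_polynomial (m ℓ : ℕ) (hm : 1 ≤ m)
    (s' : Fin ℓ → ℤ) (hs' : ∀ i, 1 ≤ s' i) (hs1 : ∀ h : 0 < ℓ, 2 ≤ s' ⟨0, h⟩)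
    (r' : Fin ℓ → ℤ) (hr' : ∀ i, 0 < r' i) (c : ℝ) (hc : 0 < c) :
    ∃ P : Polynomial ℂ,
      P.degree = m ∧
      P.coeff m =
        (if 1 ≤ ℓ then ∑' n : DecSeq ℓ, ∏ i, 1 / ((n.1 i : ℂ) ^ (s' i)) else 1) /
          (Nat.factorial m : ℂ) ∧
      Tendsto (fun ε : ℝ =>
          Zreg (m + ℓ)
            (fun i => if h : (i : ℕ) < m then 1 else s' ⟨(i : ℕ) - m, by have := i.isLt; omega⟩)
            (fun i => if h : (i : ℕ) < m then c
              else (r' ⟨(i : ℕ) - m, by have := i.isLt; omega⟩ : ℝ)) (ε : ℂ)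
            - P.eval (((-Real.log c - Real.log (-ε) : ℝ)) : ℂ))
        (nhdsWithin 0 (Set.Iio (0 : ℝ))) (nhds 0) := by
  set l : List (ℝ × ℤ) := List.ofFn fun i => ((r' i : ℝ), s' i) with hl_def
  have hl : ∀ q ∈ l, 0 < q.1 ∧ 1 ≤ q.2 := by
    intro q hq
    obtain ⟨i, rfl⟩ := (List.mem_ofFn' _ _).1 hq
    exact ⟨Int.cast_pos.2 (hr' i), hs' i⟩
  have hl1 : ∀ q ∈ l.head?, 2 ≤ q.2 := by
    intro q hq
    cases ℓ with
    | zero => simp [hl_def] at hq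
    | succ ℓ =>
      simp only [hl_def, List.ofFn_succ, List.head?_cons, Option.mem_some_iff] at hq
      rw [← hq]
      exact hs1 (Nat.succ_pos ℓ)
  obtain ⟨ζ, hζ, V, Q, hV, hQ, hdeg, hcoeff⟩ := logPolyLimit_nestedSum hc m hl hl1
  have hw : ∀ t, expWeights l t = List.ofFn fun i => expWeight (r' i : ℝ) (s' i) t := by
    intro t
    rw [expWeights, hl_def, List.map_ofFn]
    rfl
  rw [hw] at hζ
  have hsum := hasSum_prod_expWeight s' (fun i => (r' i : ℝ)) hζ
  have hζ_pos : 0 < ζ := by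
    have hpos : ∀ n : DecSeq ℓ, 0 < ∏ i, expWeight (r' i : ℝ) (s' i) 0 (n.1 i - 1) :=
      fun n => Finset.prod_pos fun i _ => expWeight_pos _ _ _ _
    rw [← hsum.tsum_eq]
    refine hsum.summable.tsum_pos (fun n => (hpos n).le)
      ⟨fun i => ℓ - i, fun i j hij => ?_, fun i => ?_⟩ (hpos _)
    · have := i.isLt
      have := j.isLt
      have : (i : ℕ) < j := hij
      dsimp only
      omega
    · exact Nat.sub_pos_of_lt i.isLt
  have hζ_eq : (if 1 ≤ ℓ then ∑' n : DecSeq ℓ, ∏ i, 1 / ((n.1 i : ℂ) ^ (s' i)) else 1) =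
      (ζ : ℂ) := by
    split_ifs with h
    · rw [← (Complex.hasSum_ofReal.2 hsum).tsum_eq]
      refine tsum_congr fun n => ?_
      rw [prod_expWeight_eq]
      simp
    · obtain rfl : ℓ = 0 := by omega
      have h1 : nestedSum (List.ofFn fun i : Fin 0 => expWeight (r' i : ℝ) (s' i) 0) =
          fun _ => 1 := by
        ext M
        simp [nestedSum]
      rw [h1] at hζ
      rw [tendsto_nhds_unique hζ tendsto_const_nhds, Complex.ofReal_one]
  have hcoeff' : (Q.map (algebraMap ℝ ℂ)).coeff m = (ζ : ℂ) / (Nat.factorial m : ℂ) := by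
    rw [Polynomial.coeff_map, hcoeff, div_eq_inv_mul]
    simp
  refine ⟨Q.map (algebraMap ℝ ℂ), ?_, ?_, ?_⟩
  · refine Polynomial.degree_eq_of_le_of_coeff_ne_zero
      (Polynomial.degree_le_of_natDegree_le ((Polynomial.natDegree_map_le).trans hdeg)) ?_
    rw [hcoeff']
    exact div_ne_zero (Complex.ofReal_ne_zero.2 hζ_pos.ne')
      (Nat.cast_ne_zero.2 m.factorial_ne_zero)
  · rw [hcoeff', hζ_eq]
  · have h0 := hQ 0
    simp only [pow_zero, mul_one] at h0
    have hneg : Tendsto (fun ε : ℝ => -ε) (nhdsWithin 0 (Set.Iio 0))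
        (nhdsWithin 0 (Set.Ioi 0)) := by
      simpa using tendsto_neg_nhdsLT (a := (0 : ℝ))
    have h := (Complex.continuous_ofReal.tendsto 0).comp (h0.comp hneg)
    rw [Complex.ofReal_zero] at h
    refine h.congr' ?_
    filter_upwards [hneg.eventually (Ioc_mem_nhdsGT (one_pos : (0 : ℝ) < 1))] with ε hε
    have hZ := hV (-ε) hε
    have hlist : List.replicate m (expWeight c 1 (-ε)) ++ expWeights l (-ε) =
        List.ofFn fun i : Fin (m + ℓ) => expWeight
          (if h : (i : ℕ) < m then c
            else (r' ⟨(i : ℕ) - m, by have := i.isLt; omega⟩ : ℝ))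
          (if h : (i : ℕ) < m then 1 else s' ⟨(i : ℕ) - m, by have := i.isLt; omega⟩) (-ε) := by
      rw [List.ofFn_add, hw]
      simp
    simp only [hlist] at hZ
    have hZ' := Zreg_neg_eq _ _ hZ
    rw [neg_neg] at hZ'
    rw [hZ']
    have heval : ∀ x : ℝ, (Q.map (algebraMap ℝ ℂ)).eval (x : ℂ) = ((Q.eval x : ℝ) : ℂ) := fun x =>
      Polynomial.eval_map_apply (algebraMap ℝ ℂ) x
    rw [heval]
    simp
end
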